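/- For every integer n ≥ 2, the infimum over nonzero smooth compactly supported functions φ on (0,∞) of the quotient (∫_0^∞ φ'(r)² sinh(r)^n dr) / (∫_0^∞ φ(r)² cosh(r)² sinh(r)^{n-2} dr) equals (n-1)²/4. -/

import Mathlib

open MeasureTheory Real Set

lemma aux_pos (m : ℕ) (φ : ℝ → ℝ) (h1 : ContDiff ℝ (⊤ : ℕ∞) φ) (h2 : HasCompactSupport φ)
    (h3 : tsupport φ ⊆ Ioi 0) (h4 : φ ≠ 0) :
    0 < ∫ r in Ioi (0:ℝ), (φ r)^2 * (Real.cosh r)^2 * (Real.sinh r)^m := by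
  have hz : ∀ x, x ∉ Ioi (0:ℝ) → φ x = 0 := fun x hx => by
    by_contra h
    exact hx (h3 (subset_tsupport _ h))
  rw [setIntegral_eq_integral_of_forall_compl_eq_zero (fun x hx => by simp [hz x hx])]
  obtain ⟨x, hx⟩ := Function.ne_iff.1 h4
  have hx0 : (0:ℝ) < x := by
    by_contra h
    exact hx (hz x h)
  have hc := h1.continuous
  have hc1 := Real.continuous_cosh
  have hc2 := Real.continuous_sinh
  have hs : HasCompactSupport (fun r => (φ r)^2 * (Real.cosh r)^2 * (Real.sinh r)^m) := by
    refine h2.mono fun y hy => ?_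
    intro h
    apply hy
    simp [h]
  refine Continuous.integral_pos_of_hasCompactSupport_nonneg_nonzero (x := x) ?_ hs ?_ ?_
  · fun_prop
  · intro r
    by_cases hr : 0 < r
    · have := Real.sinh_pos_iff.2 hr
      simp only [Pi.zero_apply]
      positivity
    · simp [hz r hr]
  · have := Real.sinh_pos_iff.2 hx0
    have := Real.cosh_pos x
    have h : φ x ≠ 0 := hx
    positivity

lemma aux_lower (m : ℕ) (φ : ℝ → ℝ) (h1 : ContDiff ℝ (⊤ : ℕ∞) φ) (h2 : HasCompactSupport φ)
    (h3 : tsupport φ ⊆ Ioi 0) :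
    (((m:ℝ)+1)/2)^2 * (∫ r in Ioi (0:ℝ), (φ r)^2 * (Real.cosh r)^2 * (Real.sinh r)^m) ≤
      ∫ r in Ioi (0:ℝ), (deriv φ r)^2 * (Real.sinh r)^(m+2) := by
  have hz : ∀ x, x ∉ Ioi (0:ℝ) → φ x = 0 := fun x hx => by
    by_contra h
    exact hx (h3 (subset_tsupport _ h))
  have hz' : ∀ x, x ∉ Ioi (0:ℝ) → deriv φ x = 0 := fun x hx => by
    by_contra h
    exact hx (h3 (support_deriv_subset h))
  rw [setIntegral_eq_integral_of_forall_compl_eq_zero (fun x hx => by simp [hz x hx]),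
    setIntegral_eq_integral_of_forall_compl_eq_zero (fun x hx => by simp [hz' x hx])]
  have hc := h1.continuous
  have hc' : Continuous (deriv φ) := h1.continuous_deriv (by simp)
  have hc1 := Real.continuous_cosh
  have hc2 := Real.continuous_sinh
  have hd2 : HasCompactSupport (deriv φ) := h2.deriv
  have hdiff : ∀ x, HasDerivAt φ (deriv φ x) x := fun x =>
    (h1.differentiable (by simp) x).hasDerivAt
  set a : ℝ := ((m:ℝ)+1)/2 with ha
  -- integrability
  have key : ∀ g : ℝ → ℝ, Continuous g → (∀ x, φ x = 0 → deriv φ x = 0 → g x = 0) →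
      Integrable g := by
    intro g hg h
    refine hg.integrable_of_hasCompactSupport ?_
    refine HasCompactSupport.intro (K := tsupport φ) h2 fun x hx => h x ?_ ?_
    · exact image_eq_zero_of_notMem_tsupport hx
    · by_contra h'
      exact hx (support_deriv_subset h')
  let F' : ℝ → ℝ := fun r => 2 * φ r * deriv φ r * (cosh r * sinh r^(m+1))
    + (φ r)^2 * (sinh r * sinh r^(m+1) + cosh r * ((m+1) * sinh r^m * cosh r))
  have hF : ∀ r, HasDerivAt (fun r => (φ r)^2 * (cosh r * sinh r^(m+1))) (F' r) r := by
    intro r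
    have e1 := (hdiff r).pow 2
    have e2 := (Real.hasDerivAt_cosh r).mul ((Real.hasDerivAt_sinh r).pow (m+1))
    refine (e1.mul e2).congr_deriv ?_
    simp [F']
  have hF'i : Integrable F' := key _ (by fun_prop) (fun x h h' => by simp [F', h])
  have hI := integral_eq_zero_of_hasDerivAt_of_integrable hF hF'i
    (key _ (by fun_prop) (fun x h h' => by simp [h]))
  have iN : Integrable (fun r => (deriv φ r)^2 * (Real.sinh r)^(m+2)) :=
    key _ (by fun_prop) (fun x h h' => by simp [h'])
  have iD : Integrable (fun r => (φ r)^2 * (Real.cosh r)^2 * (Real.sinh r)^m) :=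
    key _ (by fun_prop) (fun x h h' => by simp [h])
  have hnn : 0 ≤ ∫ r, ((deriv φ r)^2 * (Real.sinh r)^(m+2)
      - a^2 * ((φ r)^2 * (Real.cosh r)^2 * (Real.sinh r)^m) + a * F' r) := by
    apply integral_nonneg
    intro r
    by_cases hr : 0 < r
    · have hs := Real.sinh_pos_iff.2 hr
      have : (deriv φ r)^2 * (Real.sinh r)^(m+2)
        - a^2 * ((φ r)^2 * (Real.cosh r)^2 * (Real.sinh r)^m) + a * F' r =
        sinh r ^ m * (deriv φ r * sinh r + a * φ r * cosh r)^2 + a * (φ r)^2 * sinh r^(m+2) := by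
        have : (m:ℝ) = 2 * a - 1 := by rw [ha]; ring
        simp only [F', this]
        ring
      simp only [Pi.zero_apply]
      rw [this]
      positivity
    · have e1 := hz r hr
      have e2 := hz' r hr
      simp [F', e1, e2]
  have iS : Integrable (fun r => (deriv φ r)^2 * (Real.sinh r)^(m+2)
      - a^2 * ((φ r)^2 * (Real.cosh r)^2 * (Real.sinh r)^m)) := iN.sub (iD.const_mul _)
  rw [integral_add iS (hF'i.const_mul _),
    integral_sub iN (iD.const_mul _), integral_const_mul, integral_const_mul, hI] at hnn
  linarith

lemma aux_cov (g : ℝ → ℝ) :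
    ∫ r in Ioi (0:ℝ), (cosh r / sinh r) * g (log (sinh r)) = ∫ t, g t := by
  have him : (fun r => log (sinh r)) '' Ioi (0:ℝ) = univ := by
    rw [eq_univ_iff_forall]
    intro t
    refine ⟨arsinh (exp t), ?_, ?_⟩
    · simp [exp_pos]
    · simp
  have := integral_image_eq_integral_abs_deriv_smul (s := Ioi (0:ℝ))
    (f := fun r => log (sinh r)) (f' := fun r => cosh r / sinh r) measurableSet_Ioi
    (fun x hx => ((Real.hasDerivAt_sinh x).log
      (Real.sinh_pos_iff.2 hx).ne').hasDerivWithinAt)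
    (fun x hx y hy h => Real.sinh_injective
      (Real.log_injOn_pos (Real.sinh_pos_iff.2 hx) (Real.sinh_pos_iff.2 hy) h)) g
  rw [him, Measure.restrict_univ] at this
  rw [this]
  refine setIntegral_congr_fun measurableSet_Ioi fun r hr => ?_
  have := Real.sinh_pos_iff.2 hr
  have := Real.cosh_pos r
  simp only [smul_eq_mul]
  rw [abs_of_pos (by positivity)]

lemma aux_trial (m : ℕ) (η : ℝ → ℝ) (h1 : ContDiff ℝ (⊤ : ℕ∞) η) (A B : ℝ)
    (hη : ∀ t, t ∉ Icc A B → η t = 0) (hne : η ≠ 0) :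
    ∃ φ : ℝ → ℝ, ContDiff ℝ (⊤ : ℕ∞) φ ∧ HasCompactSupport φ ∧ tsupport φ ⊆ Ioi 0 ∧
      φ ≠ 0 ∧
      (∫ r in Ioi (0:ℝ), (deriv φ r)^2 * (Real.sinh r)^(m+2)) =
        (∫ t, (deriv η t - ((m:ℝ)+1)/2 * η t)^2 * √(1 + exp t ^ 2)) ∧
      (∫ r in Ioi (0:ℝ), (φ r)^2 * (Real.cosh r)^2 * (Real.sinh r)^m) =
        ∫ t, (η t)^2 * √(1 + exp t ^ 2) := by
  set a : ℝ := ((m:ℝ)+1)/2 with ha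
  let ζ : ℝ → ℝ := fun t => exp (-(a * t)) * η t
  let φ : ℝ → ℝ := fun r => if 0 < r then ζ (log (sinh r)) else 0
  have hζ : ContDiff ℝ (⊤ : ℕ∞) ζ := by
    simp only [ζ]
    fun_prop
  have hφpos : ∀ r, 0 < r → φ r = ζ (log (sinh r)) := fun r hr => by simp [φ, hr]
  have hsupp : ∀ r, r ∉ Icc (arsinh (exp A)) (arsinh (exp B)) → φ r = 0 := by
    intro r hr
    by_cases h0 : 0 < r
    · rw [hφpos r h0]
      have hs := Real.sinh_pos_iff.2 h0
      have : η (log (sinh r)) = 0 := by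
        apply hη
        intro ⟨h, h'⟩
        apply hr
        rw [Real.le_log_iff_exp_le hs] at h
        rw [Real.log_le_iff_le_exp hs] at h'
        constructor
        · rw [← Real.arsinh_sinh r]; exact Real.arsinh_le_arsinh.2 h
        · rw [← Real.arsinh_sinh r]; exact Real.arsinh_le_arsinh.2 h'
      simp [ζ, this]
    · simp [φ, h0]
  have hA : 0 < arsinh (exp A) := by simp [exp_pos]
  have hts : tsupport φ ⊆ Icc (arsinh (exp A)) (arsinh (exp B)) := by
    refine closure_minimal (fun x hx => ?_) isClosed_Icc
    by_contra h
    exact hx (hsupp x h)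
  have hev : ∀ r, 0 < r → φ =ᶠ[nhds r] (fun r => ζ (log (sinh r))) := fun r hr => by
    filter_upwards [Ioi_mem_nhds hr] with x hx using hφpos x hx
  refine ⟨φ, ?_, ?_, ?_, ?_, ?_, ?_⟩
  · rw [contDiff_iff_contDiffAt]
    intro r
    by_cases h0 : 0 < r
    · refine ContDiffAt.congr_of_eventuallyEq ?_ (hev r h0)
      exact hζ.contDiffAt.comp r
        ((Real.contDiff_sinh.contDiffAt).log (Real.sinh_pos_iff.2 h0).ne')
    · refine ContDiffAt.congr_of_eventuallyEq (contDiffAt_const (c := (0:ℝ))) ?_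
      filter_upwards [Iio_mem_nhds (lt_of_le_of_lt (not_lt.1 h0) hA)] with x hx
      exact hsupp x fun h => absurd h.1 (not_le.2 hx)
  · exact HasCompactSupport.intro isCompact_Icc hsupp
  · exact hts.trans fun x hx => lt_of_lt_of_le hA hx.1
  · obtain ⟨t, ht⟩ := Function.ne_iff.1 hne
    intro h
    have h' := congrFun h (arsinh (exp t))
    rw [hφpos _ (by simp [exp_pos])] at h'
    simp [ζ] at h'
    exact ht h'
  · rw [← aux_cov]
    refine setIntegral_congr_fun measurableSet_Ioi fun r hr => ?_
    have hs := Real.sinh_pos_iff.2 hr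
    have hd : HasDerivAt φ ((exp (-(a * log (sinh r))) *
        (deriv η (log (sinh r)) - a * η (log (sinh r)))) * (cosh r / sinh r)) r := by
      refine HasDerivAt.congr_of_eventuallyEq ?_ (hev r hr)
      have e1 : HasDerivAt (fun r => log (sinh r)) (cosh r / sinh r) r :=
        (Real.hasDerivAt_sinh r).log hs.ne'
      have e2 : HasDerivAt ζ (exp (-(a * log (sinh r))) *
        (deriv η (log (sinh r)) - a * η (log (sinh r)))) (log (sinh r)) := by
        have e3 := (((hasDerivAt_id (log (sinh r))).const_mul a).neg).exp
        have e4 := (h1.differentiable (by simp) (log (sinh r))).hasDerivAt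
        refine (e3.mul e4).congr_deriv ?_
        simp
        ring
      exact e2.comp r e1
    have he : exp (-(a * log (sinh r)))^2 = (sinh r ^ (m+1))⁻¹ := by
      rw [← Real.exp_nat_mul, ← Real.exp_log (pow_pos hs (m+1)), ← Real.exp_neg, Real.log_pow]
      congr 1
      push_cast
      rw [ha]; ring
    rw [hd.deriv, Real.exp_log hs, mul_pow, mul_pow, he, add_comm 1 (sinh r ^2),
      ← Real.cosh_sq, Real.sqrt_sq (Real.cosh_pos r).le]
    field_simp
    ring
  · rw [← aux_cov]
    refine setIntegral_congr_fun measurableSet_Ioi fun r hr => ?_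
    have hs := Real.sinh_pos_iff.2 hr
    have he : exp (-(a * log (sinh r)))^2 = (sinh r ^ (m+1))⁻¹ := by
      rw [← Real.exp_nat_mul, ← Real.exp_log (pow_pos hs (m+1)), ← Real.exp_neg, Real.log_pow]
      congr 1
      push_cast
      rw [ha]; ring
    rw [hφpos r hr]
    simp only [ζ]
    rw [Real.exp_log hs, mul_pow, he, add_comm 1 (sinh r ^2),
      ← Real.cosh_sq, Real.sqrt_sq (Real.cosh_pos r).le]
    field_simp
    ring

lemma aux_upper (m : ℕ) : ∃ K : ℝ, ∀ k : ℕ, 3 ≤ k →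
    ∃ φ : ℝ → ℝ, ContDiff ℝ (⊤ : ℕ∞) φ ∧ HasCompactSupport φ ∧ tsupport φ ⊆ Ioi 0 ∧
      φ ≠ 0 ∧
      (∫ r in Ioi (0:ℝ), (deriv φ r)^2 * (Real.sinh r)^(m+2)) /
      (∫ r in Ioi (0:ℝ), (φ r)^2 * (Real.cosh r)^2 * (Real.sinh r)^m) ≤
        (1 + 1 / (k:ℝ)) * ((((m:ℝ)+1)/2)^2 + K * (1 / (k:ℝ))^2) := by
  let f : ContDiffBump (0:ℝ) := ⟨1, 2, by norm_num, by norm_num⟩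
  have hf : ContDiff ℝ (⊤ : ℕ∞) f := f.contDiff
  have hf0 : f 0 = 1 := f.one_of_mem_closedBall (by simp [f])
  have hfz : ∀ x : ℝ, 2 < |x| → f x = 0 := fun x hx =>
    f.zero_of_le_dist (by simpa [f] using hx.le)
  set P : ℝ := ∫ t, (f t)^2 with hP
  set Q : ℝ := ∫ t, (deriv f t)^2 with hQ
  have hPpos : 0 < P := by
    refine Continuous.integral_pos_of_hasCompactSupport_nonneg_nonzero (x := 0) ?_ ?_ ?_ ?_
    · have := hf.continuous
      fun_prop
    · refine f.hasCompactSupport.mono fun y hy h => hy ?_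
      simp [h]
    · intro r
      simp only [Pi.zero_apply]
      positivity
    · simp [hf0]
  refine ⟨Q / P, fun k hk => ?_⟩
  have hk3 : (3:ℝ) ≤ k := by exact_mod_cast hk
  have hk0 : (0:ℝ) < k := by linarith
  set a : ℝ := ((m:ℝ)+1)/2 with ha
  let η : ℝ → ℝ := fun t => f (t / k + k)
  have hη : ContDiff ℝ (⊤ : ℕ∞) η := by
    simp only [η]
    exact hf.comp (by fun_prop)
  have hηz : ∀ t, t ∉ Icc (-((k:ℝ)^2+2*k)) (-(k:ℝ)) → η t = 0 := by
    intro t ht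
    apply hfz
    by_contra h
    apply ht
    rw [not_lt, abs_le] at h
    obtain ⟨h, h'⟩ := h
    have e1 : t = (t / k) * k := by field_simp
    constructor
    · rw [e1]; nlinarith
    · rw [e1]; nlinarith
  have hηne : η ≠ 0 := by
    intro h
    have h' := congrFun h (-(k:ℝ)^2)
    have e : -(k:ℝ)^2 / k + k = 0 := by field_simp; ring
    simp only [η, e, hf0, Pi.zero_apply] at h'
    exact one_ne_zero h'
  obtain ⟨φ, p1, p2, p3, p4, p5, p6⟩ := aux_trial m η hη _ _ hηz hηne
  refine ⟨φ, p1, p2, p3, p4, ?_⟩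
  rw [p5, p6]
  have hηd : ∀ t, HasDerivAt η (deriv f (t / k + k) * (1 / k)) t := by
    intro t
    have e1 : HasDerivAt (fun t : ℝ => t / k + k) (1 / k) t :=
      ((hasDerivAt_id t).div_const _).add_const _
    exact HasDerivAt.comp (h₂ := (f : ℝ → ℝ)) (h := fun t : ℝ => t / k + k) t
      (hf.differentiable (by simp) (t / k + k)).hasDerivAt e1
  have hcs : HasCompactSupport η := HasCompactSupport.intro isCompact_Icc hηz
  have hc := hη.continuous
  have hc' : Continuous (deriv η) := hη.continuous_deriv (by simp)
  have hηz' : ∀ t, t ∉ Icc (-((k:ℝ)^2+2*k)) (-(k:ℝ)) → deriv η t = 0 := by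
    intro t ht
    have : η =ᶠ[nhds t] fun _ => 0 := by
      filter_upwards [isClosed_Icc.isOpen_compl.mem_nhds ht] with x hx using hηz x hx
    rw [this.deriv_eq]
    simp
  have key : ∀ g : ℝ → ℝ, Continuous g → (∀ x, η x = 0 → deriv η x = 0 → g x = 0) →
      Integrable g := fun g hg h => hg.integrable_of_hasCompactSupport
        (HasCompactSupport.intro isCompact_Icc fun x hx => h x (hηz x hx) (hηz' x hx))
  have scale : ∀ g : ℝ → ℝ, ∫ t, g (t / k + k) = k * ∫ t, g t := by
    intro g
    have := Measure.integral_comp_div (fun t => g (t + k)) (k:ℝ)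
    rw [this, integral_add_right_eq_self, abs_of_pos hk0, smul_eq_mul]
  have iP : ∫ t, (η t)^2 = k * P := scale (fun t => (f t)^2)
  have iQ : ∫ t, (deriv η t)^2 = k * P * (Q / P * (1 / (k:ℝ))^2) := by
    have : ∀ t, (deriv η t)^2 = (deriv f (t / k + k))^2 * (1/(k:ℝ))^2 := fun t => by
      rw [(hηd t).deriv]; ring
    simp_rw [this]
    rw [integral_mul_const, scale (fun t => (deriv f t)^2)]
    field_simp
    exact hQ.symm
  have iX : ∫ t, 2 * η t * deriv η t = 0 := by
    refine integral_eq_zero_of_hasDerivAt_of_integrable (f := fun t => (η t)^2) ?_ ?_ ?_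
    · intro t
      have := ((hη.differentiable (by simp) t).hasDerivAt).pow 2
      refine this.congr_deriv ?_
      simp
    · exact key _ (by fun_prop) (fun x h h' => by simp [h])
    · exact key _ (by fun_prop) (fun x h h' => by simp [h])
  have hD : k * P ≤ ∫ t, (η t)^2 * √(1 + exp t ^ 2) := by
    rw [← iP]
    refine integral_mono (key _ (by fun_prop) (fun x h h' => by simp [h]))
      (key _ (by fun_prop) (fun x h h' => by simp [h])) fun t => ?_
    have : 1 ≤ √(1 + exp t ^ 2) := by
      rw [Real.one_le_sqrt]
      nlinarith [exp_pos t]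
    exact le_mul_of_one_le_right (sq_nonneg _) this
  have hN : ∫ t, (deriv η t - a * η t)^2 * √(1 + exp t ^ 2) ≤
      (1 + 1/(k:ℝ)) * ∫ t, (deriv η t - a * η t)^2 := by
    rw [← integral_const_mul]
    refine integral_mono (key _ (by fun_prop) (fun x h h' => by simp [h, h']))
      (key _ (by fun_prop) (fun x h h' => by simp [h, h'])) fun t => ?_
    by_cases ht : t ∈ Icc (-((k:ℝ)^2+2*k)) (-(k:ℝ))
    · have e1 : exp t ≤ 1 / k := by
        calc exp t ≤ exp (-k) := exp_le_exp.2 ht.2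
          _ = 1 / exp k := by rw [exp_neg]; simp
          _ ≤ 1 / k := by
            apply one_div_le_one_div_of_le hk0
            linarith [add_one_le_exp (k:ℝ)]
      have e2 : √(1 + exp t ^ 2) ≤ 1 + 1/(k:ℝ) := by
        apply Real.sqrt_le_iff.2
        constructor
        · positivity
        · nlinarith [exp_pos t]
      simp only
      rw [mul_comm]
      exact mul_le_mul_of_nonneg_right e2 (sq_nonneg _)
    · simp [hηz t ht, hηz' t ht]
  have hE : ∫ t, (deriv η t - a * η t)^2 = k * P * (a^2 + Q / P * (1 / (k:ℝ))^2) := by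
    have : ∀ t, (deriv η t - a * η t)^2 =
      (deriv η t)^2 - a * (2 * η t * deriv η t) + a^2 * (η t)^2 := fun t => by ring
    simp_rw [this]
    have j1 : Integrable (fun t => (deriv η t)^2) :=
      key _ (by fun_prop) (fun x h h' => by simp [h'])
    have j2 : Integrable (fun t => a * (2 * η t * deriv η t)) :=
      key _ (by fun_prop) (fun x h h' => by simp [h'])
    have j3 : Integrable (fun t => a^2 * (η t)^2) :=
      key _ (by fun_prop) (fun x h h' => by simp [h])
    have j4 : Integrable (fun t => (deriv η t)^2 - a * (2 * η t * deriv η t)) := j1.sub j2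
    rw [integral_add j4 j3, integral_sub j1 j2, integral_const_mul,
      integral_const_mul, iX, iQ, iP]
    ring
  have hkP : 0 < k * P := by positivity
  have hQ0 : 0 ≤ Q := integral_nonneg fun t => sq_nonneg _
  have hC : 0 ≤ (1 + 1 / (k:ℝ)) * (a^2 + Q / P * (1 / (k:ℝ))^2) := by positivity
  rw [div_le_iff₀ (lt_of_lt_of_le hkP hD)]
  rw [hE] at hN
  have := mul_le_mul_of_nonneg_left hD hC
  linarith

theorem stmt_4 (n : ℕ) (hn : 2 ≤ n) :
    sInf {q : ℝ | ∃ φ : ℝ → ℝ, ContDiff ℝ (⊤ : ℕ∞) φ ∧ HasCompactSupport φ ∧ tsupport φ ⊆ Ioi 0 ∧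
      φ ≠ 0 ∧
      q = (∫ r in Ioi (0:ℝ), (deriv φ r)^2 * (Real.sinh r)^n) /
          (∫ r in Ioi (0:ℝ), (φ r)^2 * (Real.cosh r)^2 * (Real.sinh r)^(n-2))} =
      ((n : ℝ) - 1)^2 / 4 := by
  obtain ⟨m, rfl⟩ : ∃ m, n = m + 2 := ⟨n - 2, by omega⟩
  have hm : m + 2 - 2 = m := by omega
  rw [hm]
  have hv : (((m + 2 : ℕ) : ℝ) - 1)^2 / 4 = (((m:ℝ)+1)/2)^2 := by push_cast; ring
  rw [hv]
  obtain ⟨K, hK⟩ := aux_upper m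
  have hlow : ∀ q ∈ {q : ℝ | ∃ φ : ℝ → ℝ, ContDiff ℝ (⊤ : ℕ∞) φ ∧ HasCompactSupport φ ∧
      tsupport φ ⊆ Ioi 0 ∧ φ ≠ 0 ∧
      q = (∫ r in Ioi (0:ℝ), (deriv φ r)^2 * (Real.sinh r)^(m+2)) /
          (∫ r in Ioi (0:ℝ), (φ r)^2 * (Real.cosh r)^2 * (Real.sinh r)^m)},
      (((m:ℝ)+1)/2)^2 ≤ q := by
    rintro q ⟨φ, h1, h2, h3, h4, rfl⟩
    rw [le_div_iff₀ (aux_pos m φ h1 h2 h3 h4)]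
    exact aux_lower m φ h1 h2 h3
  apply le_antisymm
  · have ht : Filter.Tendsto (fun k : ℕ => (1 + 1 / (k:ℝ)) *
        ((((m:ℝ)+1)/2)^2 + K * (1 / (k:ℝ))^2)) Filter.atTop
        (nhds ((1 + 0) * ((((m:ℝ)+1)/2)^2 + K * 0^2))) := by
      have h0 := tendsto_one_div_atTop_nhds_zero_nat (𝕜 := ℝ)
      exact (h0.const_add 1).mul (((h0.pow 2).const_mul K).const_add _)
    have e : (1 + 0) * ((((m:ℝ)+1)/2)^2 + K * 0^2) = (((m:ℝ)+1)/2)^2 := by ring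
    rw [e] at ht
    refine ge_of_tendsto ht ?_
    filter_upwards [Filter.eventually_ge_atTop 3] with k hk
    obtain ⟨φ, h1, h2, h3, h4, h5⟩ := hK k hk
    exact (csInf_le ⟨_, hlow⟩ ⟨φ, h1, h2, h3, h4, rfl⟩).trans h5
  · refine le_csInf ?_ hlow
    obtain ⟨φ, h1, h2, h3, h4, h5⟩ := hK 3 le_rfl
    exact ⟨_, φ, h1, h2, h3, h4, rfl⟩
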